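/- Finiteness of the nonlocal pairing: let u : ℝ^d → ℝ be a bounded Borel function with u|_D ∈ W^{1,2}_loc(D), and let φ ∈ C_c^∞(D). Then the double integral ∫_{ℝ^d}∫_{ℝ^d} |u(x) − u(y)| · |φ(x) − φ(y)| / |x − y|^{d+α} dx dy is finite. -/

import Mathlib

open MeasureTheory Real Filter Metric
open scoped RealInnerProductSpace ENNReal NNReal

noncomputable section

/-- Euclidean space `ℝ^d`. -/
abbrev Ed (d : ℕ) : Type := EuclideanSpace ℝ (Fin d)

/-- `φ` is a smooth compactly supported test function on the open set `D`. -/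
def IsTestFn {d : ℕ} (D : Set (Ed d)) (φ : Ed d → ℝ) : Prop :=
  ContDiff ℝ (⊤ : ℕ∞) φ ∧ HasCompactSupport φ ∧ tsupport φ ⊆ D

/-- The normalizing constant `𝒜(d, -α)` of the fractional Laplacian. -/
def Acst (d : ℕ) (α : ℝ) : ℝ :=
  α * 2 ^ (α - 1) * π ^ (-(d : ℝ) / 2) * Gamma (((d : ℝ) + α) / 2) / Gamma (1 - α / 2)

/-- `gu` is a (measurable) weak gradient of `u` on `D`. -/
def HasWeakGradOn {d : ℕ} (D : Set (Ed d)) (u : Ed d → ℝ) (gu : Ed d → Ed d) : Prop :=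
  Measurable gu ∧
  ∀ φ : Ed d → ℝ, IsTestFn D φ → ∀ i : Fin d,
    ∫ x in D, u x * fderiv ℝ φ x (EuclideanSpace.single i 1) =
      - ∫ x in D, gu x i * φ x

/-- `u ∈ W^{1,2}_loc(D)`, with weak gradient `gu`. -/
def MemW12loc {d : ℕ} (D : Set (Ed d)) (u : Ed d → ℝ) (gu : Ed d → Ed d) : Prop :=
  HasWeakGradOn D u gu ∧
  ∀ K : Set (Ed d), K ⊆ D → IsCompact K →
    IntegrableOn (fun x => u x ^ 2) K volume ∧
    IntegrableOn (fun x => ‖gu x‖ ^ 2) K volume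


section helpers

open Set ContinuousLinearMap
open scoped Convolution Topology

lemma aux_smooth {d : ℕ} (v : Ed d → ℝ) (hv : ContDiff ℝ 1 v) (A B : Set (Ed d))
    (hA : MeasurableSet A) (hB : MeasurableSet B) (z : Ed d)
    (h : ∀ x ∈ A, ∀ t ∈ Icc (0:ℝ) 1, x + t • z ∈ B) :
    ∫⁻ x in A, ‖v (x + z) - v x‖ₑ ≤ ‖z‖ₑ * ∫⁻ x in B, ‖fderiv ℝ v x‖ₑ := by
  have hc : Continuous (fderiv ℝ v) := hv.continuous_fderiv (by simp)
  have h1 : ∀ x, ‖v (x + z) - v x‖ₑ ≤ ∫⁻ t in Ioc (0:ℝ) 1, ‖fderiv ℝ v (x + t • z)‖ₑ * ‖z‖ₑ := by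
    intro x
    have hd : ∀ t ∈ uIcc (0:ℝ) 1, HasDerivAt (fun t : ℝ => v (x + t • z))
        (fderiv ℝ v (x + t • z) z) t := by
      intro t _
      have e1 : HasDerivAt (fun t : ℝ => x + t • z) z t := by
        simpa using ((hasDerivAt_id t).smul_const z).const_add x
      exact ((hv.differentiable (by simp)) (x + t • z)).hasFDerivAt.comp_hasDerivAt t e1
    have hi := intervalIntegral.integral_eq_sub_of_hasDerivAt hd
      (Continuous.intervalIntegrable (by fun_prop) _ _)
    simp only [one_smul, zero_smul, add_zero] at hi
    rw [← hi, intervalIntegral.integral_of_le zero_le_one]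
    refine (enorm_integral_le_lintegral_enorm _).trans (lintegral_mono fun t => ?_)
    exact ContinuousLinearMap.le_opENorm _ _
  calc ∫⁻ x in A, ‖v (x + z) - v x‖ₑ
      ≤ ∫⁻ x in A, ∫⁻ t in Ioc (0:ℝ) 1, ‖fderiv ℝ v (x + t • z)‖ₑ * ‖z‖ₑ := lintegral_mono fun x => h1 x
    _ = ∫⁻ t in Ioc (0:ℝ) 1, ∫⁻ x in A, ‖fderiv ℝ v (x + t • z)‖ₑ * ‖z‖ₑ := by
        rw [lintegral_lintegral_swap]
        apply Measurable.aemeasurable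
        apply Continuous.measurable
        simp only [Function.uncurry_def]
        exact ENNReal.continuous_mul_const (by simp) |>.comp (by fun_prop)
    _ ≤ ∫⁻ t in Ioc (0:ℝ) 1, ‖z‖ₑ * ∫⁻ x in B, ‖fderiv ℝ v x‖ₑ := by
        apply setLIntegral_mono' measurableSet_Ioc
        intro t ht
        rw [lintegral_mul_const _ (by fun_prop), mul_comm]
        refine mul_le_mul_right ?_ _
        rw [← lintegral_indicator hA, ← lintegral_indicator hB,
          ← lintegral_add_right_eq_self (B.indicator _) (t • z)]
        apply lintegral_mono
        intro x
        by_cases hx : x ∈ A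
        · simp [hx, h x hx t ⟨ht.1.le, ht.2⟩]
        · simp [hx]
    _ = _ := by simp

lemma aux_opnorm {d : ℕ} (T : Ed d →L[ℝ] ℝ) :
    ‖T‖ₑ ≤ ∑ i : Fin d, ‖T (EuclideanSpace.single i 1)‖ₑ := by
  have h : ‖T‖ ≤ ∑ i : Fin d, ‖T (EuclideanSpace.single i 1)‖ := by
    apply T.opNorm_le_bound (Finset.sum_nonneg fun _ _ => norm_nonneg _)
    intro v
    have hv : v = ∑ i : Fin d, v i • EuclideanSpace.single i (1:ℝ) := by
      ext j
      simp [Finset.sum_apply, Pi.single_apply]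
    conv_lhs => rw [hv, map_sum]
    rw [Finset.sum_mul]
    refine (norm_sum_le _ _).trans (Finset.sum_le_sum fun i _ => ?_)
    rw [map_smul, norm_smul, mul_comm]
    gcongr
    exact PiLp.norm_apply_le v i
  rw [← ofReal_norm]
  refine (ENNReal.ofReal_le_ofReal h).trans ?_
  rw [ENNReal.ofReal_sum_of_nonneg fun _ _ => norm_nonneg _]
  simp only [ofReal_norm, le_refl]

lemma aux_grad {d : ℕ} (D : Set (Ed d))
    (u : Ed d → ℝ) (hul : LocallyIntegrable u volume)
    (gu : Ed d → Ed d) (hW : HasWeakGradOn D u gu) (B K : Set (Ed d)) (hB : MeasurableSet B)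
    (hK : MeasurableSet K)
    (f : ContDiffBump (0 : Ed d)) (hBK : cthickening f.rOut B ⊆ K) (hKD : K ⊆ D) :
    ∫⁻ x in B, ‖fderiv ℝ (f.normed volume ⋆[lsmul ℝ ℝ, volume] u) x‖ₑ
      ≤ d * ∫⁻ x in K, ‖gu x‖ₑ := by
  set ρ := f.normed (volume : Measure (Ed d)) with hρ
  have hρs : ContDiff ℝ (⊤ : ℕ∞) ρ := f.contDiff_normed
  have hρc : HasCompactSupport ρ := f.hasCompactSupport_normed
  have hgm := hW.1
  have key : ∀ x ∈ B, ∀ i, ‖fderiv ℝ (ρ ⋆[lsmul ℝ ℝ, volume] u) x (EuclideanSpace.single i 1)‖ₑ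
      ≤ ∫⁻ y, ‖ρ (x - y)‖ₑ * K.indicator (fun y => ‖gu y‖ₑ) y := by
    intro x hx i
    have h1 := (hρc.hasFDerivAt_convolution_left (lsmul ℝ ℝ) (hρs.of_le (by simp)) hul x).fderiv
    have hsupp : tsupport (fun y => ρ (x - y)) ⊆ K := by
      have : tsupport (fun y => ρ (x - y)) ⊆ closedBall x f.rOut := by
        apply closure_minimal _ isClosed_closedBall
        intro y hy
        have : x - y ∈ Function.support ρ := hy
        rw [hρ, f.support_normed_eq] at this
        simp only [Metric.mem_ball, dist_zero_right] at this
        rw [Metric.mem_closedBall, dist_comm, dist_eq_norm]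
        exact this.le
      intro y hy
      exact hBK (mem_cthickening_of_dist_le y x _ _ hx (this hy))
    have htest : IsTestFn D (fun y => ρ (x - y)) := by
      refine ⟨hρs.comp (contDiff_const.sub contDiff_id), ?_, hsupp.trans hKD⟩
      exact hρc.comp_homeomorph (Homeomorph.subLeft x)
    have h2 := hW.2 _ htest i
    have hfd : ∀ y, fderiv ℝ (fun y => ρ (x - y)) y (EuclideanSpace.single i 1)
        = - fderiv ℝ ρ (x - y) (EuclideanSpace.single i 1) := by
      intro y
      have e1 : HasFDerivAt (fun y : Ed d => x - y) (-(ContinuousLinearMap.id ℝ (Ed d))) y :=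
        (hasFDerivAt_id y).const_sub x
      have e2 := ((hρs.differentiable (by simp)) (x - y)).hasFDerivAt.comp y e1
      have e3 : fderiv ℝ (fun y => ρ (x - y)) y = _ := e2.fderiv
      rw [e3]; simp
    have hz : ∀ y, y ∉ D → ρ (x - y) = 0 := by
      intro y hy
      by_contra hne
      exact hy (hKD (hsupp (subset_tsupport _ hne)))
    have hz' : ∀ y, y ∉ D → fderiv ℝ (fun y => ρ (x - y)) y = 0 := by
      intro y hy
      by_contra hne
      exact hy (hKD (hsupp (tsupport_fderiv_subset ℝ (subset_tsupport _ hne))))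
    rw [setIntegral_eq_integral_of_forall_compl_eq_zero (fun y hy => by simp [hz' y hy]),
      setIntegral_eq_integral_of_forall_compl_eq_zero (fun y hy => by simp [hz y hy])] at h2
    have h3 : fderiv ℝ (ρ ⋆[lsmul ℝ ℝ, volume] u) x (EuclideanSpace.single i 1)
        = ∫ y, gu y i * ρ (x - y) := by
      rw [h1, convolution_eq_swap, ContinuousLinearMap.integral_apply]
      · rw [← neg_eq_iff_eq_neg.mpr h2, ← integral_neg]
        congr 1; ext y
        rw [hfd]
        simp [ContinuousLinearMap.precompL_apply, mul_comm]
      · have := (hρc.fderiv ℝ).convolutionExists_left (((lsmul ℝ ℝ : ℝ →L[ℝ] ℝ →L[ℝ] ℝ)).precompL (Ed d)) (hρs.continuous_fderiv (by simp)) hul x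
        exact this.integrable_swap
    rw [h3]
    refine (enorm_integral_le_lintegral_enorm _).trans (lintegral_mono fun y => ?_)
    by_cases hy : y ∈ K
    · simp only [hy, indicator_of_mem, enorm_mul]
      rw [mul_comm]
      gcongr
      exact enorm_le_iff_norm_le.mpr (PiLp.norm_apply_le _ i)
    · have : ρ (x - y) = 0 := by
        by_contra hne
        exact hy (hsupp (subset_tsupport _ hne))
      simp [this]
  have hone : ∫⁻ x, ‖ρ x‖ₑ = 1 := by
    rw [← ENNReal.ofReal_one, ← f.integral_normed (μ := volume),
      ofReal_integral_eq_lintegral_ofReal f.integrable_normed (ae_of_all _ fun x => f.nonneg_normed x)]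
    apply lintegral_congr
    intro x
    exact Real.enorm_of_nonneg (f.nonneg_normed x)
  have hind : Measurable (K.indicator (fun y => ‖gu y‖ₑ)) := (hgm.enorm).indicator hK
  calc _ ≤ ∫⁻ x in B, ∑ i : Fin d, ∫⁻ y, ‖ρ (x - y)‖ₑ * K.indicator (fun y => ‖gu y‖ₑ) y := by
        apply setLIntegral_mono' hB
        intro x hx
        exact (aux_opnorm _).trans (Finset.sum_le_sum fun i _ => key x hx i)
    _ ≤ ∫⁻ x, ∑ i : Fin d, ∫⁻ y, ‖ρ (x - y)‖ₑ * K.indicator (fun y => ‖gu y‖ₑ) y :=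
        setLIntegral_le_lintegral _ _
    _ = d * ∫⁻ x, ∫⁻ y, ‖ρ (x - y)‖ₑ * K.indicator (fun y => ‖gu y‖ₑ) y := by
        simp only [Finset.sum_const, Finset.card_univ, Fintype.card_fin, nsmul_eq_mul]
        rw [lintegral_const_mul' _ _ (by simp)]
    _ = d * ∫⁻ y, ∫⁻ x, ‖ρ (x - y)‖ₑ * K.indicator (fun y => ‖gu y‖ₑ) y := by
        rw [lintegral_lintegral_swap]
        apply Measurable.aemeasurable
        apply Measurable.mul
        · exact (hρs.continuous.comp (continuous_fst.sub continuous_snd)).measurable.enorm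
        · exact hind.comp measurable_snd
    _ = d * ∫⁻ y, K.indicator (fun y => ‖gu y‖ₑ) y := by
        congr 2; ext y
        have hρm : Measurable fun x => ‖ρ (x - y)‖ₑ :=
          (hρs.continuous.comp (continuous_id.sub continuous_const)).measurable.enorm
        rw [lintegral_mul_const _ hρm,
          lintegral_sub_right_eq_self (fun x => ‖ρ x‖ₑ) y, hone, one_mul]
    _ = _ := by rw [lintegral_indicator hK]

lemma aux_trans {d : ℕ} (D : Set (Ed d))
    (u : Ed d → ℝ) (hul : LocallyIntegrable u volume)
    (gu : Ed d → Ed d) (hW : HasWeakGradOn D u gu) (K : Set (Ed d)) (δ : ℝ) (hδ : 0 < δ)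
    (hKD : cthickening (3 * δ) K ⊆ D) (z : Ed d) (hz : ‖z‖ ≤ δ) :
    ∫⁻ x in cthickening δ K, ‖u (x + z) - u x‖ₑ
      ≤ ‖z‖ₑ * (d * ∫⁻ x in cthickening (3 * δ) K, ‖gu x‖ₑ) := by
  let f : ℕ → ContDiffBump (0 : Ed d) := fun n =>
    ⟨δ / (n + 1) / 2, δ / (n + 1), by positivity, half_lt_self (by positivity)⟩
  let w : ℕ → Ed d → ℝ := fun n => (f n).normed volume ⋆[lsmul ℝ ℝ, volume] u
  have hw : ∀ n, ContDiff ℝ 1 (w n) := fun n =>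
    (f n).hasCompactSupport_normed.contDiff_convolution_left (lsmul ℝ ℝ) (f n).contDiff_normed hul
  have hbd : ∀ n, ∫⁻ x in cthickening δ K, ‖w n (x + z) - w n x‖ₑ
      ≤ ‖z‖ₑ * (d * ∫⁻ x in cthickening (3 * δ) K, ‖gu x‖ₑ) := by
    intro n
    refine (aux_smooth (w n) (hw n) _ (cthickening (2 * δ) K) isClosed_cthickening.measurableSet
      isClosed_cthickening.measurableSet z ?_).trans ?_
    · intro x hx t ht
      have := cthickening_cthickening_subset hδ.le hδ.le K
      rw [two_mul]
      apply this
      apply mem_cthickening_of_dist_le _ x _ _ hx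
      rw [dist_eq_norm, add_sub_cancel_left, norm_smul, Real.norm_of_nonneg ht.1]
      nlinarith [ht.2, norm_nonneg z]
    · gcongr
      refine aux_grad D u hul gu hW _ _ isClosed_cthickening.measurableSet
        isClosed_cthickening.measurableSet (f n) ?_ hKD
      have h1 : (f n).rOut ≤ δ := div_le_self hδ.le (by simp)
      refine (cthickening_mono h1 _).trans ?_
      refine (cthickening_cthickening_subset hδ.le (by positivity) K).trans ?_
      rw [show δ + 2 * δ = 3 * δ by ring]
  have hae : ∀ᵐ x, Tendsto (fun n => w n x) atTop (𝓝 (u x)) := by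
    refine ContDiffBump.ae_convolution_tendsto_right_of_locallyIntegrable (K := 2) ?_ ?_ hul
    · show Tendsto (fun n : ℕ => δ / ((n : ℝ) + 1)) atTop (𝓝 0)
      simpa [div_eq_mul_inv] using (tendsto_one_div_add_atTop_nhds_zero_nat (𝕜 := ℝ)).const_mul δ
    · refine Eventually.of_forall fun n => ?_
      show δ / (n + 1) ≤ 2 * (δ / (n + 1) / 2)
      linarith
  have hae2 : ∀ᵐ x, Tendsto (fun n => w n (x + z)) atTop (𝓝 (u (x + z))) :=
    (measurePreserving_add_right volume z).quasiMeasurePreserving.ae hae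
  calc _ = ∫⁻ x in cthickening δ K, liminf (fun n => ‖w n (x + z) - w n x‖ₑ) atTop := by
        apply lintegral_congr_ae
        apply ae_restrict_of_ae
        filter_upwards [hae, hae2] with x h1 h2
        exact ((h2.sub h1).enorm).liminf_eq.symm
    _ ≤ liminf (fun n => ∫⁻ x in cthickening δ K, ‖w n (x + z) - w n x‖ₑ) atTop := by
        apply lintegral_liminf_le
        intro n
        have := (hw n).continuous
        fun_prop
    _ ≤ _ := by
        refine (liminf_le_liminf (Eventually.of_forall hbd)).trans ?_
        simp


/-- Radial majorant: near the origin `y^(2-d-α)`, far away `y^(-d-α)`. -/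
def radMaj (d : ℕ) (α δ : ℝ) (y : ℝ) : ℝ :=
  if y < δ then y * (y / y ^ ((d : ℝ) + α)) else 1 / y ^ ((d : ℝ) + α)

lemma radMaj_nonneg (d : ℕ) (α δ y : ℝ) (hy : 0 ≤ y) : 0 ≤ radMaj d α δ y := by
  unfold radMaj
  split_ifs <;> positivity

lemma aux_rad (d : ℕ) (hd : 1 ≤ d) (α : ℝ) (hα : 0 < α) (hα' : α < 2) (δ : ℝ) (hδ : 0 < δ) :
    Integrable (fun z : Ed d => radMaj d α δ ‖z‖) volume := by
  have : Nonempty (Fin d) := ⟨⟨0, hd⟩⟩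
  have : Nontrivial (Ed d) := inferInstance
  rw [integrable_fun_norm_addHaar (μ := (volume : Measure (Ed d))) (f := radMaj d α δ)]
  rw [← Ioo_union_Ici_eq_Ioi hδ]
  have hfr : Module.finrank ℝ (Ed d) = d := by simp
  rw [hfr]
  have hcast : ((d - 1 : ℕ) : ℝ) = (d : ℝ) - 1 := by push_cast [hd]; ring
  apply IntegrableOn.union
  · have h := (intervalIntegral.integrableOn_Ioo_rpow_iff (s := 1 - α) hδ).2 (by linarith)
    refine h.congr_fun (fun y hy => ?_) measurableSet_Ioo
    have hy0 : 0 < y := hy.1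
    simp only [radMaj, hy.2, if_true, smul_eq_mul]
    rw [← Real.rpow_natCast, hcast]
    have : y ^ (1 - α) = y ^ ((d:ℝ) - 1) * (y ^ (1:ℝ) * (y ^ (1:ℝ) * y ^ (-((d:ℝ) + α)))) := by
      rw [← Real.rpow_add hy0, ← Real.rpow_add hy0, ← Real.rpow_add hy0]
      congr 1; ring
    rw [this, Real.rpow_neg hy0.le, Real.rpow_one, div_eq_mul_inv]
  · rw [integrableOn_Ici_iff_integrableOn_Ioi]
    have h := integrableOn_Ioi_rpow_of_lt (a := -1 - α) (by linarith) hδ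
    refine h.congr_fun (fun y hy => ?_) measurableSet_Ioi
    have hy' : δ < y := hy
    have hy0 : 0 < y := hδ.trans hy'
    simp only [radMaj, not_lt.2 hy'.le, if_false, smul_eq_mul]
    rw [← Real.rpow_natCast, hcast]
    have : y ^ (-1 - α) = y ^ ((d:ℝ) - 1) * y ^ (-((d:ℝ) + α)) := by
      rw [← Real.rpow_add hy0]
      congr 1; ring
    rw [this, Real.rpow_neg hy0.le, one_div]

end helpers

/-- **Finiteness of the nonlocal pairing.**  If `u : ℝ^d → ℝ` is a bounded Borel function with
`u|_D ∈ W^{1,2}_loc(D)` and `φ ∈ C_c^∞(D)`, then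
`∫∫ |u(x) - u(y)| |φ(x) - φ(y)| / |x - y|^{d+α} dx dy < ∞`. -/
theorem finiteness_nonlocal_pairing
    (d : ℕ) (hd : 1 ≤ d) (α : ℝ) (hα : 0 < α) (hα' : α < 2)
    (D : Set (Ed d)) (hD : IsOpen D) (hDb : Bornology.IsBounded D)
    (u : Ed d → ℝ) (hum : Measurable u) (Cu : ℝ) (hub : ∀ x, |u x| ≤ Cu)
    (gu : Ed d → Ed d) (hW : MemW12loc D u gu)
    (φ : Ed d → ℝ) (hφ : IsTestFn D φ) :
    ∫⁻ x, ∫⁻ y, ENNReal.ofReal (|u x - u y| * |φ x - φ y| / ‖x - y‖ ^ ((d : ℝ) + α)) < ⊤ := by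
  classical
  obtain ⟨hφs, hφc, hφD⟩ := hφ
  have hφcont : Continuous φ := hφs.continuous
  have hCu : 0 ≤ Cu := (abs_nonneg _).trans (hub 0)
  have hul : LocallyIntegrable u volume := by
    refine (locallyIntegrable_const (μ := (volume : Measure (Ed d))) Cu).mono
      hum.aestronglyMeasurable (ae_of_all _ fun x => ?_)
    rw [Real.norm_eq_abs, Real.norm_of_nonneg hCu]
    exact hub x
  obtain ⟨L, hL⟩ := ContDiff.lipschitzWith_of_hasCompactSupport hφc hφs (by simp)
  set K := tsupport φ with hK
  have hKc : IsCompact K := hφc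
  obtain ⟨δ₀, hδ₀, hδD⟩ := hKc.exists_cthickening_subset_open hD hφD
  obtain ⟨δ, hδ, hδe⟩ : ∃ δ : ℝ, 0 < δ ∧ 3 * δ = δ₀ := ⟨δ₀ / 3, by positivity, by ring⟩
  rw [← hδe] at hδD
  set K3 := cthickening (3 * δ) K with hK3
  have hK3c : IsCompact K3 := hKc.cthickening
  have hG : ∫⁻ x in K3, ‖gu x‖ₑ < ⊤ := by
    have h2 := (hW.2 K3 hδD hK3c).2
    have h1 : IntegrableOn (fun _ : Ed d => (1 : ℝ)) K3 volume :=
      integrableOn_const hK3c.measure_lt_top.ne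
    have h3 : IntegrableOn gu K3 volume := by
      refine Integrable.mono' (h1.add h2) hW.1.1.aestronglyMeasurable (ae_of_all _ fun x => ?_)
      show ‖gu x‖ ≤ 1 + ‖gu x‖ ^ 2
      nlinarith [sq_nonneg (‖gu x‖ - 1)]
    exact h3.2
  set G := ∫⁻ x in K3, ‖gu x‖ₑ with hGdef
  have hP : ∫⁻ x, ‖φ x‖ₑ < ⊤ := (hφcont.integrable_of_hasCompactSupport hφc).2
  set P := ∫⁻ x, ‖φ x‖ₑ with hPdef
  set M : ℝ≥0∞ := (L : ℝ≥0∞) * (d * G) + ENNReal.ofReal (2 * Cu) * (P + P) with hM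
  have hMtop : M < ⊤ := by
    rw [hM]
    refine ENNReal.add_lt_top.2 ⟨?_, ?_⟩
    · exact ENNReal.mul_lt_top ENNReal.coe_lt_top (ENNReal.mul_lt_top (by simp) hG)
    · exact ENNReal.mul_lt_top ENNReal.ofReal_lt_top (ENNReal.add_lt_top.2 ⟨hP, hP⟩)
  set F : Ed d → Ed d → ℝ≥0∞ := fun x z =>
    ENNReal.ofReal (|u x - u (x + z)| * |φ x - φ (x + z)| / ‖z‖ ^ ((d : ℝ) + α)) with hF
  have step1 : ∀ x, ∫⁻ y, ENNReal.ofReal (|u x - u y| * |φ x - φ y| / ‖x - y‖ ^ ((d : ℝ) + α))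
      = ∫⁻ z, F x z := by
    intro x
    rw [← lintegral_add_left_eq_self _ x]
    apply lintegral_congr
    intro z
    simp [hF]
  have hFm : Measurable (Function.uncurry F) := by
    simp only [hF, Function.uncurry_def]
    have := hφcont.measurable
    fun_prop
  have step2 : ∀ z, ∫⁻ x, F x z ≤ M * ENNReal.ofReal (radMaj d α δ ‖z‖) := by
    intro z
    by_cases hz : ‖z‖ < δ
    · have hpt : ∀ x, F x z ≤ ENNReal.ofReal (L * (‖z‖ / ‖z‖ ^ ((d : ℝ) + α))) *
          (cthickening δ K).indicator (fun x => ‖u (x + z) - u x‖ₑ) x := by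
        intro x
        by_cases hx : x ∈ cthickening δ K
        · simp only [hx, Set.indicator_of_mem]
          rw [← ofReal_norm, ← ENNReal.ofReal_mul (by positivity)]
          apply ENNReal.ofReal_le_ofReal
          have h1 : |φ x - φ (x + z)| ≤ L * ‖z‖ := by
            have := hL.dist_le_mul x (x + z)
            simpa [Real.dist_eq] using this
          rw [Real.norm_eq_abs, abs_sub_comm (u (x + z))]
          calc _ ≤ |u x - u (x + z)| * (L * ‖z‖) / ‖z‖ ^ ((d : ℝ) + α) := by gcongr
            _ = _ := by ring
        · have h1 : φ x = 0 := by
            by_contra hne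
            exact hx (self_subset_cthickening K (subset_tsupport _ hne))
          have h2 : φ (x + z) = 0 := by
            by_contra hne
            refine hx (mem_cthickening_of_dist_le x (x + z) _ _ (subset_tsupport _ hne) ?_)
            simpa using hz.le
          simp [hF, h1, h2]
      calc ∫⁻ x, F x z ≤ ENNReal.ofReal (L * (‖z‖ / ‖z‖ ^ ((d : ℝ) + α))) *
            ∫⁻ x in cthickening δ K, ‖u (x + z) - u x‖ₑ := by
            rw [← lintegral_indicator isClosed_cthickening.measurableSet,
              ← lintegral_const_mul' _ _ ENNReal.ofReal_ne_top]
            exact lintegral_mono hpt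
        _ ≤ ENNReal.ofReal (L * (‖z‖ / ‖z‖ ^ ((d : ℝ) + α))) * (‖z‖ₑ * (d * G)) := by
            gcongr
            exact aux_trans D u hul gu hW.1 K δ hδ hδD z hz.le
        _ = (L : ℝ≥0∞) * (d * G) * ENNReal.ofReal (radMaj d α δ ‖z‖) := by
            rw [radMaj, if_pos hz, ENNReal.ofReal_mul (by positivity),
              ENNReal.ofReal_mul (norm_nonneg z), ofReal_norm, ENNReal.ofReal_coe_nnreal]
            ring
        _ ≤ _ := by
            gcongr
            rw [hM]
            exact le_self_add
    · have hpt : ∀ x, F x z ≤ (ENNReal.ofReal (2 * Cu) * ENNReal.ofReal (radMaj d α δ ‖z‖)) *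
          (‖φ x‖ₑ + ‖φ (x + z)‖ₑ) := by
        intro x
        rw [← ofReal_norm, ← ofReal_norm, ← ENNReal.ofReal_add (by positivity) (by positivity),
          ← ENNReal.ofReal_mul (by positivity),
          ← ENNReal.ofReal_mul (mul_nonneg (by positivity) (radMaj_nonneg _ _ _ _ (norm_nonneg z)))]
        apply ENNReal.ofReal_le_ofReal
        have h1 : |u x - u (x + z)| ≤ 2 * Cu := by
          have := abs_sub (u x) (u (x + z))
          linarith [hub x, hub (x + z)]
        have h2 : |φ x - φ (x + z)| ≤ ‖φ x‖ + ‖φ (x + z)‖ := norm_sub_le (φ x) (φ (x + z))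
        rw [radMaj, if_neg hz]
        calc _ ≤ (2 * Cu) * (‖φ x‖ + ‖φ (x + z)‖) / ‖z‖ ^ ((d : ℝ) + α) := by gcongr
          _ = _ := by ring
      calc ∫⁻ x, F x z ≤ ∫⁻ x, (ENNReal.ofReal (2 * Cu) * ENNReal.ofReal (radMaj d α δ ‖z‖)) *
            (‖φ x‖ₑ + ‖φ (x + z)‖ₑ) := lintegral_mono hpt
        _ = (ENNReal.ofReal (2 * Cu) * ENNReal.ofReal (radMaj d α δ ‖z‖)) * (P + P) := by
            rw [lintegral_const_mul' _ _ (by finiteness), lintegral_add_left (by fun_prop),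
              lintegral_add_right_eq_self (fun x => ‖φ x‖ₑ) z]
        _ = (ENNReal.ofReal (2 * Cu) * (P + P)) * ENNReal.ofReal (radMaj d α δ ‖z‖) := by ring
        _ ≤ _ := by
            gcongr
            rw [hM]
            exact le_add_self
  simp_rw [step1]
  rw [lintegral_lintegral_swap hFm.aemeasurable]
  refine (lintegral_mono step2).trans_lt ?_
  rw [lintegral_const_mul' _ _ hMtop.ne]
  refine ENNReal.mul_lt_top hMtop ?_
  rw [← ofReal_integral_eq_lintegral_ofReal (aux_rad d hd α hα hα' δ hδ)
    (ae_of_all _ fun z => radMaj_nonneg _ _ _ _ (norm_nonneg z))]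
  exact ENNReal.ofReal_lt_top
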